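/- arXiv:2112.06236 — 3 statements merged into one kernel-verified Lean document; each statement's English description precedes it below -/
import Mathlib

section
/- Let G be a finite group and let H ≤ A ≤ L ≤ G be subgroups. If A is a perfect code of the pair (G,H), then A is a perfect code of the pair (L,H). -/
open scoped Pointwise

/-- A perfect code in a graph: an independent set `C` of vertices such that every
vertex outside of `C` is adjacent to exactly one vertex in `C`. -/
def IsPerfectCode {V : Type*} (Γ : SimpleGraph V) (C : Set V) : Prop :=
  (∀ a ∈ C, ∀ b ∈ C, ¬ Γ.Adj a b) ∧ ∀ v ∉ C, ∃! c, c ∈ C ∧ Γ.Adj v c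

/-- A total perfect code in a graph: a set `C` of vertices such that every vertex
of the graph is adjacent to exactly one vertex in `C`. -/
def IsTotalPerfectCode {V : Type*} (Γ : SimpleGraph V) (C : Set V) : Prop :=
  ∀ v, ∃! c, c ∈ C ∧ Γ.Adj v c

/-- The coset graph `Cos(G,H,U)`: vertices are the left cosets of `H` in `G`, and
`g₁H` is adjacent to `g₂H` iff `g₁⁻¹ * g₂ ∈ U`.  (When `HUH = U`, `H ∩ U = ∅` and
`U⁻¹ = U`, this matches the usual definition.) -/
def cosetGraph {G : Type*} [Group G] (H : Subgroup G) (U : Set G) :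
    SimpleGraph (G ⧸ H) :=
  SimpleGraph.fromRel fun x y =>
    ∃ g₁ g₂ : G, QuotientGroup.mk g₁ = x ∧ QuotientGroup.mk g₂ = y ∧ g₁⁻¹ * g₂ ∈ U

/-- `A` is a perfect code of the pair `(G,H)`: there is `U ⊆ G` with `HUH = U`,
`H ∩ U = ∅`, `U⁻¹ = U` such that `A/H = {aH : a ∈ A}` is a perfect code in the
coset graph `Cos(G,H,U)`. -/
def IsPerfectCodePair {G : Type*} [Group G] (H A : Subgroup G) : Prop :=
  ∃ U : Set G,
    (H : Set G) * U * (H : Set G) = U ∧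
    (H : Set G) ∩ U = ∅ ∧
    U⁻¹ = U ∧
    IsPerfectCode (cosetGraph H U) ((QuotientGroup.mk : G → G ⧸ H) '' (A : Set G))

/-- `A` is a total perfect code of the pair `(G,H)`. -/
def IsTotalPerfectCodePair {G : Type*} [Group G] (H A : Subgroup G) : Prop :=
  ∃ U : Set G,
    (H : Set G) * U * (H : Set G) = U ∧
    (H : Set G) ∩ U = ∅ ∧
    U⁻¹ = U ∧
    IsTotalPerfectCode (cosetGraph H U) ((QuotientGroup.mk : G → G ⧸ H) '' (A : Set G))

/-- A left transversal of `A` in `G`: a set containing exactly one element of each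
left coset of `A`. -/
def IsLeftTransversal {G : Type*} [Group G] (X : Set G) (A : Subgroup G) : Prop :=
  ∀ g : G, ∃! x, x ∈ X ∧ g⁻¹ * x ∈ A

/-- A right transversal of `A` in `G`: a set containing exactly one element of each
right coset of `A`. -/
def IsRightTransversal {G : Type*} [Group G] (Y : Set G) (A : Subgroup G) : Prop :=
  ∀ g : G, ∃! y, y ∈ Y ∧ y * g⁻¹ ∈ A

section CosetGraph

variable {G : Type*} [Group G]

theorem mul_mem_of_mul_mul_eq {H : Subgroup G} {U : Set G}
    (hU : (H : Set G) * U * (H : Set G) = U) {a u b : G} (ha : a ∈ H) (hu : u ∈ U)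
    (hb : b ∈ H) : a * u * b ∈ U :=
  hU ▸ Set.mul_mem_mul (Set.mul_mem_mul ha hu) hb

theorem cosetGraph_adj_mk {H : Subgroup G} {U : Set G}
    (hU : (H : Set G) * U * (H : Set G) = U) (hdisj : (H : Set G) ∩ U = ∅) (hinv : U⁻¹ = U)
    (a b : G) : (cosetGraph H U).Adj (a : G ⧸ H) (b : G ⧸ H) ↔ a⁻¹ * b ∈ U := by
  have key : ∀ a b : G, (∃ g₁ g₂ : G, (g₁ : G ⧸ H) = a ∧ (g₂ : G ⧸ H) = b ∧ g₁⁻¹ * g₂ ∈ U) ↔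
      a⁻¹ * b ∈ U := by
    refine fun a b => ⟨?_, fun h => ⟨a, b, rfl, rfl, h⟩⟩
    rintro ⟨g₁, g₂, h₁, h₂, h⟩
    have h₁' := QuotientGroup.eq.1 h₁.symm
    have h₂' := QuotientGroup.eq.1 h₂
    simpa [mul_assoc] using mul_mem_of_mul_mul_eq hU h₁' h h₂'
  have hsymm : b⁻¹ * a ∈ U ↔ a⁻¹ * b ∈ U := by
    rw [← hinv, Set.mem_inv]
    simp [hinv]
  simp only [cosetGraph, SimpleGraph.fromRel_adj, key, hsymm, or_self]
  exact ⟨fun h => h.2, fun h => ⟨fun hH => (hdisj ▸ ⟨QuotientGroup.eq.1 hH, h⟩ : a⁻¹ * b ∈ (∅ : Set G)), h⟩⟩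

theorem mk_mem_image_iff {H A : Subgroup G} (hHA : H ≤ A) (g : G) :
    (g : G ⧸ H) ∈ (QuotientGroup.mk : G → G ⧸ H) '' (A : Set G) ↔ g ∈ A := by
  refine ⟨?_, fun h => ⟨g, h, rfl⟩⟩
  rintro ⟨a, ha, h⟩
  simpa using A.mul_mem ha (hHA (QuotientGroup.eq.1 h))

theorem isPerfectCode_cosetGraph_iff {H A : Subgroup G} (hHA : H ≤ A) {U : Set G}
    (hU : (H : Set G) * U * (H : Set G) = U) (hdisj : (H : Set G) ∩ U = ∅) (hinv : U⁻¹ = U) :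
    IsPerfectCode (cosetGraph H U) ((QuotientGroup.mk : G → G ⧸ H) '' (A : Set G)) ↔
      (∀ a ∈ A, ∀ b ∈ A, a⁻¹ * b ∉ U) ∧
        ∀ g ∉ A, ∃ a ∈ A, g⁻¹ * a ∈ U ∧ ∀ b ∈ A, g⁻¹ * b ∈ U → b⁻¹ * a ∈ H := by
  simp only [IsPerfectCode, ExistsUnique, (QuotientGroup.mk_surjective (s := H)).forall,
    (QuotientGroup.mk_surjective (s := H)).exists, mk_mem_image_iff hHA,
    cosetGraph_adj_mk hU hdisj hinv, QuotientGroup.eq, and_imp, and_assoc]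

end CosetGraph

/-- if `H ≤ A ≤ L ≤ G` and `A` is a perfect code of `(G,H)`, then `A`
is a perfect code of `(L,H)`. -/
theorem perfectCodePair_of_le
    {G : Type*} [Group G] [Finite G] (H A L : Subgroup G)
    (hHA : H ≤ A) (hAL : A ≤ L) (h : IsPerfectCodePair H A) :
    IsPerfectCodePair (H.subgroupOf L) (A.subgroupOf L) := by
  obtain ⟨U, hU, hdisj, hinv, hcode⟩ := h
  rw [isPerfectCode_cosetGraph_iff hHA hU hdisj hinv] at hcode
  have hV : (H.subgroupOf L : Set L) * ((↑) ⁻¹' U : Set L) * (H.subgroupOf L : Set L) =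
      ((↑) ⁻¹' U : Set L) := by
    refine subset_antisymm ?_ fun x hx => ?_
    · rintro _ ⟨_, ⟨a, ha, u, hu, rfl⟩, b, hb, rfl⟩
      exact mul_mem_of_mul_mul_eq hU ha hu hb
    · exact ⟨x, ⟨1, one_mem _, x, hx, one_mul x⟩, 1, one_mem _, mul_one x⟩
  have hVdisj : (H.subgroupOf L : Set L) ∩ ((↑) ⁻¹' U : Set L) = ∅ :=
    Set.eq_empty_of_forall_notMem fun x hx => (hdisj ▸ hx : (x : G) ∈ (∅ : Set G))
  have hVinv : ((↑) ⁻¹' U : Set L)⁻¹ = ((↑) ⁻¹' U : Set L) := by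
    ext x
    exact Set.ext_iff.1 hinv x
  refine ⟨_, hV, hVdisj, hVinv, ?_⟩
  refine (isPerfectCode_cosetGraph_iff (Subgroup.comap_mono hHA) hV hVdisj hVinv).2
    ⟨fun a ha b hb => hcode.1 a ha b hb, fun g hg => ?_⟩
  obtain ⟨a, ha, hga, huniq⟩ := hcode.2 g hg
  exact ⟨⟨a, hAL ha⟩, ha, hga, fun b hb hgb => huniq b hb hgb⟩
end

section
/- Let G be a finite group and let H ≤ A ≤ G be subgroups. If A is a perfect code of the pair (G,H), then for every g ∈ G at least one of the following holds: (i) the left coset gA contains an element x such that x² ∈ b⁻¹Hb for some b ∈ A; or (ii) the set AgA ∪ Ag⁻¹A is a disjoint union of an even number of left cosets of A in G (i.e., AgA ∪ Ag⁻¹A = g₁A ∪ ⋯ ∪ g_mA with the g_iA pairwise disjoint and m even). -/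
open scoped Pointwise

/-- A set stable under right multiplication by `H` has as many elements as `H` times the
number of left cosets it meets. -/
theorem ncard_eq_card_mul_ncard_image_mk {G : Type*} [Group G] (H : Subgroup G) {W : Set G}
    (hW : ∀ w ∈ W, ∀ h ∈ H, w * h ∈ W) :
    W.ncard = Nat.card H * ((QuotientGroup.mk : G → G ⧸ H) '' W).ncard := by
  have hWH : W * (H : Set G) = W := by
    ext x
    constructor
    · rintro ⟨w, hw, h, hh, rfl⟩
      exact hW w hw h hh
    · exact fun hx => ⟨x, hx, 1, H.one_mem, mul_one x⟩
  have := Subgroup.card_mul_eq_card_subgroup_mul_card_quotient H W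
  rw [hWH] at this
  exact this

/-- If `W` is a symmetric union of double cosets of `H` containing no element whose square
lies in `H`, then `W` consists of an even number of left cosets of `H`. -/
theorem even_ncard_image_mk {G : Type*} [Group G] [Finite G] (H : Subgroup G) {W : Set G}
    (hW : ∀ w ∈ W, ∀ h ∈ H, ∀ k ∈ H, h * w * k ∈ W) (hinv : ∀ w ∈ W, w⁻¹ ∈ W)
    (hsq : ∀ w ∈ W, w ^ 2 ∉ H) :
    Even ((QuotientGroup.mk : G → G ⧸ H) '' W).ncard := by
  classical
  let q : G → DoubleCoset.Quotient (H : Set G) (H : Set G) := DoubleCoset.mk H H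
  have q_mul : ∀ w, ∀ h ∈ H, q (w * h) = q w := fun w h hh =>
    ((DoubleCoset.eq H H _ _).2 ⟨1, H.one_mem, h, hh, by group⟩).symm
  have q_mul_inv : ∀ w, ∀ h ∈ H, q (w * h)⁻¹ = q w⁻¹ := fun w h hh =>
    ((DoubleCoset.eq H H _ _).2 ⟨h⁻¹, H.inv_mem hh, 1, H.one_mem, by group⟩).symm
  have q_ne : ∀ w ∈ W, q w ≠ q w⁻¹ := by
    intro w hw hq
    obtain ⟨h, hh, k, hk, hwk⟩ := (DoubleCoset.eq H H _ _).1 hq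
    refine hsq (w * h) (by simpa using hW w hw 1 H.one_mem h hh) ?_
    have : (w * h) ^ 2 = k⁻¹ * h := by
      have hk' : h * w = w⁻¹ * k⁻¹ := by rw [hwk]; group
      calc (w * h) ^ 2 = w * (h * w) * h := by simp only [sq, mul_assoc]
        _ = k⁻¹ * h := by rw [hk']; group
    rw [this]
    exact H.mul_mem (H.inv_mem hk) hh
  let : LinearOrder (DoubleCoset.Quotient (H : Set G) (H : Set G)) :=
    linearOrderOfSTO WellOrderingRel
  let T : Set G := {w ∈ W | q w < q w⁻¹}
  have hT : ∀ w ∈ T, ∀ h ∈ H, w * h ∈ T := by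
    rintro w ⟨hw, hlt⟩ h hh
    refine ⟨by simpa using hW w hw 1 H.one_mem h hh, ?_⟩
    rwa [q_mul w h hh, q_mul_inv w h hh]
  have hunion : W = T ∪ T⁻¹ := by
    ext w
    constructor
    · intro hw
      rcases lt_or_gt_of_ne (q_ne w hw) with hlt | hlt
      · exact Or.inl ⟨hw, hlt⟩
      · exact Or.inr ⟨hinv w hw, by simpa using hlt⟩
    · rintro (hw | hw)
      · exact hw.1
      · simpa using hinv _ hw.1
  have hdisj : Disjoint T T⁻¹ := by
    rw [Set.disjoint_left]
    rintro w ⟨-, hlt⟩ ⟨-, hgt⟩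
    rw [inv_inv] at hgt
    exact lt_asymm hlt hgt
  have hWcard : W.ncard = T.ncard + T.ncard := by
    conv_lhs => rw [hunion]
    rw [Set.ncard_union_eq hdisj, Set.ncard_inv]
  rw [ncard_eq_card_mul_ncard_image_mk H fun w hw h hh => by
      simpa using hW w hw 1 H.one_mem h hh,
    ncard_eq_card_mul_ncard_image_mk H hT, ← mul_add] at hWcard
  exact ⟨_, Nat.eq_of_mul_eq_mul_left Nat.card_pos hWcard⟩

/-- Adjacency in the coset graph can be tested on representatives. -/
theorem cosetGraph_adj_mk_s7 {G : Type*} [Group G] {H : Subgroup G} {U : Set G}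
    (hU : ∀ u ∈ U, ∀ h ∈ H, ∀ k ∈ H, h * u * k ∈ U) (hHU : ∀ u ∈ U, u ∉ H)
    (hinv : ∀ u ∈ U, u⁻¹ ∈ U) (x y : G) :
    (cosetGraph H U).Adj (x : G ⧸ H) (y : G ⧸ H) ↔ x⁻¹ * y ∈ U := by
  have key : ∀ x y : G, (∃ g₁ g₂ : G, (g₁ : G ⧸ H) = x ∧ (g₂ : G ⧸ H) = y ∧ g₁⁻¹ * g₂ ∈ U) →
      x⁻¹ * y ∈ U := by
    rintro x y ⟨g₁, g₂, h₁, h₂, hg⟩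
    convert hU _ hg _ (QuotientGroup.eq.1 h₁.symm) _ (QuotientGroup.eq.1 h₂) using 1
    group
  rw [cosetGraph, SimpleGraph.fromRel_adj]
  constructor
  · rintro ⟨-, h | h⟩
    · exact key x y h
    · simpa using hinv _ (key y x h)
  · exact fun h => ⟨fun hxy => hHU _ h (QuotientGroup.eq.1 hxy), Or.inl ⟨x, y, rfl, rfl, h⟩⟩

/-- A perfect code `A` of `(G, H)` yields a symmetric union `U` of double cosets of `H` which
meets every nontrivial left coset of `A` in exactly one left coset of `H`. -/
theorem IsPerfectCodePair.exists_connection_set {G : Type*} [Group G] {H A : Subgroup G}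
    (hHA : H ≤ A) (h : IsPerfectCodePair H A) :
    ∃ U : Set G, (∀ u ∈ U, ∀ h ∈ H, ∀ k ∈ H, h * u * k ∈ U) ∧ (∀ u ∈ U, u⁻¹ ∈ U) ∧
      (∀ u ∈ U, u ∉ A) ∧ (∀ y ∉ A, ∃ a ∈ A, y * a ∈ U) ∧
      ∀ u ∈ U, ∀ v ∈ U, u⁻¹ * v ∈ A → u⁻¹ * v ∈ H := by
  obtain ⟨U, hUU, hdisj, hUinv, hind, hdom⟩ := h
  have hU : ∀ u ∈ U, ∀ h ∈ H, ∀ k ∈ H, h * u * k ∈ U := fun u hu h hh k hk => by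
    rw [← hUU]
    exact Set.mul_mem_mul (Set.mul_mem_mul hh hu) hk
  have hinv : ∀ u ∈ U, u⁻¹ ∈ U := fun u hu => by
    rw [← hUinv]
    simpa using hu
  have hHU : ∀ u ∈ U, u ∉ H := fun u hu hh => by
    have : u ∈ (H : Set G) ∩ U := ⟨hh, hu⟩
    simp [hdisj] at this
  have hadj := cosetGraph_adj_mk_s7 hU hHU hinv
  have hA : ∀ y ∉ A, (y : G ⧸ H) ∉ (QuotientGroup.mk : G → G ⧸ H) '' (A : Set G) := by
    rintro y hy ⟨a, ha, hay⟩
    exact hy ((A.mul_mem_cancel_left (A.inv_mem ha)).1 (hHA (QuotientGroup.eq.1 hay)))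
  have hUA : ∀ u ∈ U, u ∉ A := fun u hu huA =>
    hind _ ⟨1, A.one_mem, rfl⟩ _ ⟨u, huA, rfl⟩ ((hadj 1 u).2 (by simpa using hu))
  refine ⟨U, hU, hinv, hUA, fun y hy => ?_, fun u hu v hv huv => ?_⟩
  · obtain ⟨-, ⟨⟨a, ha, rfl⟩, hya⟩, -⟩ := hdom _ (hA y⁻¹ fun h => hy (by simpa using h))
    exact ⟨a, ha, by simpa using (hadj _ _).1 hya⟩
  · have huA : u⁻¹ ∉ A := fun h => hUA u hu (by simpa using h)
    exact QuotientGroup.eq.1 <| by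
      have := (hdom _ (hA u⁻¹ huA)).unique
        ⟨⟨1, A.one_mem, rfl⟩, (hadj _ _).2 (by simpa using hu)⟩
        ⟨⟨u⁻¹ * v, huv, rfl⟩, (hadj _ _).2 (by simpa using hv)⟩
      have h1 := QuotientGroup.eq.1 this
      exact QuotientGroup.eq.2 (by simpa using h1)

/-- A set stable under right multiplication by `A` is the disjoint union of the left cosets of
`A` it meets. -/
theorem exists_disjoint_iUnion_leftCosets {G : Type*} [Group G] [Finite G] (A : Subgroup G)
    {D : Set G} (hD : ∀ x ∈ D, ∀ a ∈ A, x * a ∈ D) :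
    ∃ c : Fin ((QuotientGroup.mk : G → G ⧸ A) '' D).ncard → G,
      (Pairwise fun i j => Disjoint (c i • (A : Set G)) (c j • (A : Set G))) ∧
      D = ⋃ i, c i • (A : Set G) := by
  let e := Finite.equivFin ((QuotientGroup.mk : G → G ⧸ A) '' D)
  have hmem : ∀ i x, x ∈ (e.symm i).1.out • (A : Set G) ↔ (x : G ⧸ A) = (e.symm i).1 := by
    intro i x
    rw [mem_leftCoset_iff, SetLike.mem_coe, ← QuotientGroup.eq, QuotientGroup.out_eq', eq_comm]
  refine ⟨fun i => (e.symm i).1.out, fun i j hij => Set.disjoint_left.2 fun x hi hj => hij ?_, ?_⟩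
  · exact e.symm.injective (Subtype.ext (((hmem i x).1 hi).symm.trans ((hmem j x).1 hj)))
  · ext x
    rw [Set.mem_iUnion]
    constructor
    · exact fun hx => ⟨e ⟨x, x, hx, rfl⟩, (hmem _ x).2 (by rw [e.symm_apply_apply])⟩
    · rintro ⟨i, hi⟩
      obtain ⟨d, hd, hde⟩ := (e.symm i).2
      have := hD d hd _ (QuotientGroup.eq.1 (hde.trans ((hmem i x).1 hi).symm))
      rwa [mul_inv_cancel_left] at this

/-- if `A` is a perfect code of `(G,H)`, then for every `g ∈ G` either
`gA` contains an element `x` with `x² ∈ b⁻¹Hb` for some `b ∈ A`, or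
`AgA ∪ Ag⁻¹A` is a disjoint union of an even number of left cosets of `A`. -/
theorem perfectCodePair_necessary
    {G : Type*} [Group G] [Finite G] (H A : Subgroup G) (hHA : H ≤ A)
    (h : IsPerfectCodePair H A) (g : G) :
    (∃ x ∈ g • (A : Set G), ∃ b ∈ A, ∃ h' ∈ H, x ^ 2 = b⁻¹ * h' * b) ∨
    (∃ m : ℕ, Even m ∧ ∃ c : Fin m → G,
      (Pairwise fun i j => Disjoint (c i • (A : Set G)) (c j • (A : Set G))) ∧
      (A : Set G) * {g, g⁻¹} * (A : Set G) = ⋃ i, c i • (A : Set G)) := by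
  obtain ⟨U, hU, hUinv, hUA, hex, huniq⟩ := h.exists_connection_set hHA
  refine or_iff_not_imp_left.2 fun hno => ?_
  have hgA : g ∉ A := fun hg =>
    hno ⟨1, ⟨g⁻¹, A.inv_mem hg, by simp⟩, 1, A.one_mem, 1, H.one_mem, by simp⟩
  set D : Set G := (A : Set G) * {g, g⁻¹} * (A : Set G) with hDdef
  have hmemD : ∀ x, x ∈ D ↔ ∃ a ∈ A, ∃ b ∈ A, x = a * g * b ∨ x = a * g⁻¹ * b := by
    intro x
    constructor
    · rintro ⟨-, ⟨a, ha, y, rfl | rfl, rfl⟩, b, hb, rfl⟩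
      · exact ⟨a, ha, b, hb, Or.inl rfl⟩
      · exact ⟨a, ha, b, hb, Or.inr rfl⟩
    · rintro ⟨a, ha, b, hb, rfl | rfl⟩
      · exact Set.mul_mem_mul (Set.mul_mem_mul ha (by simp)) hb
      · exact Set.mul_mem_mul (Set.mul_mem_mul ha (by simp)) hb
  have hDmul : ∀ x ∈ D, ∀ a ∈ A, ∀ b ∈ A, a * x * b ∈ D := by
    intro x hx a ha b hb
    obtain ⟨a', ha', b', hb', hx⟩ := (hmemD x).1 hx
    refine (hmemD _).2 ⟨a * a', A.mul_mem ha ha', b' * b, A.mul_mem hb' hb, ?_⟩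
    rcases hx with rfl | rfl
    · exact Or.inl (by group)
    · exact Or.inr (by group)
  have hDmul_right : ∀ x ∈ D, ∀ b ∈ A, x * b ∈ D := fun x hx b hb => by
    simpa using hDmul x hx 1 A.one_mem b hb
  have hDinv : ∀ x ∈ D, x⁻¹ ∈ D := by
    intro x hx
    obtain ⟨a, ha, b, hb, hx⟩ := (hmemD x).1 hx
    refine (hmemD _).2 ⟨b⁻¹, A.inv_mem hb, a⁻¹, A.inv_mem ha, ?_⟩
    rcases hx with rfl | rfl
    · exact Or.inr (by group)
    · exact Or.inl (by group)
  have hDA : ∀ x ∈ D, x ∉ A := by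
    intro x hx hxA
    obtain ⟨a, ha, b, hb, rfl | rfl⟩ := (hmemD x).1 hx
    · exact hgA ((A.mul_mem_cancel_left ha).1 ((A.mul_mem_cancel_right hb).1 hxA))
    · exact hgA (A.inv_mem_iff.1
        ((A.mul_mem_cancel_left ha).1 ((A.mul_mem_cancel_right hb).1 hxA)))
  have hsq' : ∀ a ∈ A, ∀ b ∈ A, (a * g * b) ^ 2 ∉ H := fun a ha b hb hH =>
    hno ⟨g * (b * a), ⟨b * a, A.mul_mem hb ha, rfl⟩, a, ha, _, hH, by simp only [sq]; group⟩
  have hsq : ∀ x ∈ D, x ^ 2 ∉ H := by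
    intro x hx hxH
    obtain ⟨a, ha, b, hb, rfl | rfl⟩ := (hmemD x).1 hx
    · exact hsq' a ha b hb hxH
    · refine hsq' b⁻¹ (A.inv_mem hb) a⁻¹ (A.inv_mem ha) ?_
      convert H.inv_mem hxH using 1
      rw [← inv_pow]
      group
  have heven : Even ((QuotientGroup.mk : G → G ⧸ H) '' (U ∩ D)).ncard :=
    even_ncard_image_mk H
      (fun w hw h hh k hk => ⟨hU w hw.1 h hh k hk, hDmul w hw.2 h (hHA hh) k (hHA hk)⟩)
      (fun w hw => ⟨hUinv w hw.1, hDinv w hw.2⟩) fun w hw => hsq w hw.2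
  have hbij : Set.BijOn (Subgroup.quotientMapOfLE hHA)
      ((QuotientGroup.mk : G → G ⧸ H) '' (U ∩ D)) ((QuotientGroup.mk : G → G ⧸ A) '' D) := by
    refine ⟨?_, ?_, ?_⟩
    · rintro _ ⟨w, hw, rfl⟩
      exact ⟨w, hw.2, rfl⟩
    · rintro _ ⟨w, hw, rfl⟩ _ ⟨v, hv, rfl⟩ hwv
      exact QuotientGroup.eq.2 (huniq w hw.1 v hv.1 (QuotientGroup.eq.1 hwv))
    · rintro _ ⟨x, hx, rfl⟩
      obtain ⟨a, ha, hxa⟩ := hex x (hDA x hx)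
      exact ⟨_, ⟨x * a, ⟨hxa, hDmul_right x hx a ha⟩, rfl⟩, QuotientGroup.mk_mul_of_mem x ha⟩
  exact ⟨_, hbij.ncard_eq ▸ heven, exists_disjoint_iUnion_leftCosets A hDmul_right⟩
end

section
/- Let G be a finite group and let H ≤ A ≤ G be subgroups. Then A is a total perfect code of the pair (G,H) if and only if there exists a right transversal Y of A in G such that Y⁻¹H = HY and Y contains an element of A \ H (an element of A not in H). -/
open scoped Pointwise

/-- Adjacency in `Cos(G,H,U)` can be tested on any choice of coset representatives. -/
theorem cosetGraph_adj_mk_iff {G : Type*} [Group G] {H : Subgroup G} {U : Set G}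
    (hU : (H : Set G) * U * (H : Set G) = U) (hHU : (H : Set G) ∩ U = ∅) (hinv : U⁻¹ = U)
    (a b : G) :
    (cosetGraph H U).Adj (QuotientGroup.mk a) (QuotientGroup.mk b) ↔ a⁻¹ * b ∈ U := by
  have rel_mk : ∀ a b g₁ g₂ : G, (QuotientGroup.mk g₁ : G ⧸ H) = QuotientGroup.mk a →
      (QuotientGroup.mk g₂ : G ⧸ H) = QuotientGroup.mk b → g₁⁻¹ * g₂ ∈ U → a⁻¹ * b ∈ U := by
    intro a b g₁ g₂ h₁ h₂ h
    rw [← hU]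
    refine ⟨a⁻¹ * g₁ * (g₁⁻¹ * g₂), ⟨a⁻¹ * g₁, QuotientGroup.eq.1 h₁.symm, _, h, rfl⟩,
      g₂⁻¹ * b, QuotientGroup.eq.1 h₂, ?_⟩
    simp [mul_assoc]
  simp only [cosetGraph, SimpleGraph.fromRel_adj]
  constructor
  · rintro ⟨-, ⟨g₁, g₂, h₁, h₂, h⟩ | ⟨g₁, g₂, h₁, h₂, h⟩⟩
    · exact rel_mk a b g₁ g₂ h₁ h₂ h
    · have h_inv : (b⁻¹ * a)⁻¹ ∈ U⁻¹ := Set.inv_mem_inv.2 (rel_mk b a g₁ g₂ h₁ h₂ h)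
      simpa [hinv] using h_inv
  · refine fun h => ⟨fun hab => ?_, Or.inl ⟨a, b, rfl, rfl, h⟩⟩
    exact Set.eq_empty_iff_forall_notMem.1 hHU _ ⟨QuotientGroup.eq.1 hab, h⟩

/-- `A/H` is a total perfect code in `Cos(G,H,U)` iff every right coset of `A` meets `U` in
exactly one right coset of `H`. -/
theorem isTotalPerfectCode_cosetGraph_iff {G : Type*} [Group G] {H A : Subgroup G}
    {U : Set G}
    (hU : (H : Set G) * U * (H : Set G) = U) (hHU : (H : Set G) ∩ U = ∅) (hinv : U⁻¹ = U) :
    IsTotalPerfectCode (cosetGraph H U) ((QuotientGroup.mk : G → G ⧸ H) '' (A : Set G)) ↔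
      ∀ g : G, ∃ u ∈ U, u * g⁻¹ ∈ A ∧ ∀ w ∈ U, w * g⁻¹ ∈ A → w * u⁻¹ ∈ H := by
  have mem_inv : ∀ {x}, x ∈ U → x⁻¹ ∈ U := fun {x} hx => by
    rw [← hinv]; exact Set.inv_mem_inv.2 hx
  constructor
  · intro h g
    obtain ⟨_, ⟨⟨a, ha, rfl⟩, hadj⟩, huniq⟩ := h (QuotientGroup.mk g)
    rw [cosetGraph_adj_mk_iff hU hHU hinv] at hadj
    refine ⟨a⁻¹ * g, by simpa using mem_inv hadj, by simpa using ha, fun w hw hwA => ?_⟩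
    have hga : g * w⁻¹ ∈ A := by simpa using A.inv_mem hwA
    have hw_eq := huniq (QuotientGroup.mk (g * w⁻¹)) ⟨⟨_, hga, rfl⟩, by
      rw [cosetGraph_adj_mk_iff hU hHU hinv]; simpa using mem_inv hw⟩
    simpa [mul_assoc] using QuotientGroup.eq.1 hw_eq
  · intro h v
    obtain ⟨g, rfl⟩ := QuotientGroup.mk_surjective v
    obtain ⟨u, hu, huA, huniq⟩ := h g
    have hgu : g * u⁻¹ ∈ A := by simpa using A.inv_mem huA
    refine ⟨QuotientGroup.mk (g * u⁻¹), ⟨⟨_, hgu, rfl⟩, ?_⟩, ?_⟩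
    · rw [cosetGraph_adj_mk_iff hU hHU hinv]
      simpa using mem_inv hu
    · rintro _ ⟨⟨a, ha, rfl⟩, hadj⟩
      rw [cosetGraph_adj_mk_iff hU hHU hinv] at hadj
      have hau := huniq (a⁻¹ * g) (by simpa using mem_inv hadj) (by simpa using ha)
      exact QuotientGroup.eq.2 (by simpa [mul_assoc] using hau)

/-- `A` is a total perfect code of `(G,H)` iff there is a right
transversal `Y` of `A` in `G` with `Y⁻¹H = HY` containing an element of `A \ H`. -/
theorem totalPerfectCodePair_iff_exists_rightTransversal
    {G : Type*} [Group G] [Finite G] (H A : Subgroup G) (hHA : H ≤ A) :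
    IsTotalPerfectCodePair H A ↔
      ∃ Y : Set G, IsRightTransversal Y A ∧ Y⁻¹ * (H : Set G) = (H : Set G) * Y ∧
        ∃ y ∈ Y, y ∈ A ∧ y ∉ H := by
  constructor
  · rintro ⟨U, hU, hHU, hinv, hcode⟩
    rw [isTotalPerfectCode_cosetGraph_iff hU hHU hinv] at hcode
    have mul_mem : ∀ h ∈ H, ∀ u ∈ U, h * u ∈ U := fun h hh u hu => by
      rw [← hU]
      exact ⟨h * u, ⟨h, hh, u, hu, rfl⟩, 1, H.one_mem, mul_one _⟩
    choose f hfU hfA hf using hcode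
    let r : G → G := fun g =>
      f (Quotient.out (Quotient.mk (QuotientGroup.rightRel A) g))
    have out_mem (g : G) :
        g * (Quotient.out (Quotient.mk (QuotientGroup.rightRel A) g))⁻¹ ∈ A :=
      QuotientGroup.rightRel_apply.1 (Quotient.mk_out (s := QuotientGroup.rightRel A) g)
    have hrU (g : G) : r g ∈ U := hfU _
    have hrA (g : G) : r g * g⁻¹ ∈ A := by
      simpa [mul_assoc, r] using
        A.mul_mem (hfA (Quotient.mk (QuotientGroup.rightRel A) g).out) (A.inv_mem (out_mem g))
    have hr (g w : G) (hw : w ∈ U) (hwg : w * g⁻¹ ∈ A) : w * (r g)⁻¹ ∈ H :=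
      hf _ w hw (by simpa [mul_assoc] using A.mul_mem hwg (out_mem g))
    have hr_eq {g k : G} (h : g * k⁻¹ ∈ A) : r k = r g := by
      have hq : Quotient.mk (QuotientGroup.rightRel A) k = Quotient.mk _ g :=
        Quotient.sound (QuotientGroup.rightRel_apply.2 h)
      simp only [r, hq]
    have hUY : (H : Set G) * Set.range r = U := by
      ext u
      constructor
      · rintro ⟨h, hh, _, ⟨g, rfl⟩, rfl⟩
        exact mul_mem h hh _ (hrU g)
      · intro hu
        exact ⟨u * (r u)⁻¹, hr u u hu (by simp), r u, ⟨u, rfl⟩, by simp⟩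
    refine ⟨Set.range r, fun g => ⟨r g, ⟨⟨g, rfl⟩, hrA g⟩, ?_⟩, ?_, r 1, ⟨1, rfl⟩, ?_, ?_⟩
    · rintro _ ⟨⟨k, rfl⟩, hk⟩
      apply hr_eq
      simpa [mul_assoc] using A.inv_mem (A.mul_mem (A.inv_mem (hrA k)) hk)
    · rw [hUY, ← hinv, ← hUY, mul_inv_rev, inv_coe_set]
    · simpa using hrA 1
    · exact fun h => Set.eq_empty_iff_forall_notMem.1 hHU _ ⟨h, hrU 1⟩
  · rintro ⟨Y, hY, hYH, y, hyY, hyA, hyH⟩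
    have hU : (H : Set G) * ((H : Set G) * Y) * (H : Set G) = (H : Set G) * Y := by
      rw [← mul_assoc, coe_mul_coe, ← hYH, mul_assoc, coe_mul_coe]
    have hHU : (H : Set G) ∩ ((H : Set G) * Y) = ∅ := by
      rw [Set.eq_empty_iff_forall_notMem]
      rintro _ ⟨hx, h, hh, z, hz, rfl⟩
      have hzH : z ∈ H := (H.mul_mem_cancel_left hh).1 hx
      have hzy : z = y := (hY 1).unique ⟨hz, by simpa using hHA hzH⟩ ⟨hyY, by simpa using hyA⟩
      exact hyH (hzy ▸ hzH)
    have hinv : ((H : Set G) * Y)⁻¹ = (H : Set G) * Y := by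
      rw [mul_inv_rev, inv_coe_set, hYH]
    refine ⟨_, hU, hHU, hinv, (isTotalPerfectCode_cosetGraph_iff hU hHU hinv).2 fun g => ?_⟩
    obtain ⟨z, ⟨hzY, hzA⟩, hz⟩ := hY g
    refine ⟨z, ⟨1, H.one_mem, z, hzY, one_mul z⟩, hzA, ?_⟩
    rintro _ ⟨h, hh, k, hk, rfl⟩ hkA
    have hkz : k = z := hz k ⟨hk,
      (A.mul_mem_cancel_left (hHA hh)).1 (by simpa [mul_assoc] using hkA)⟩
    simpa [hkz] using hh
end
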